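/- Let M be a fixed invertible real 3×3 matrix and let C₀ be an invertible real 3×3 matrix with det(C₀·M) = 1. Then the map g(C) := trace( (det(C·M))^{−1/3} • (C·M) ) (defined on the open set of matrices C with det(C·M) > 0) is differentiable at C₀, and its Fréchet derivative at C₀ applied to a direction H equals trace( C₀⁻¹·(C₀·M)^D · H ), where (·)^D denotes the deviatoric part. In particular, the gradient with respect to the Frobenius inner product is (C₀⁻¹·(C₀·M)^D)ᵀ. -/

import Mathlib

open Matrix

attribute [local instance] Matrix.normedAddCommGroup Matrix.normedSpace

/-- The deviatoric part of a real `3×3` matrix: `A^D = A − (trace A / 3) • 1`. -/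
noncomputable def dev (A : Matrix (Fin 3) (Fin 3) ℝ) : Matrix (Fin 3) (Fin 3) ℝ :=
  A - (A.trace / 3) • (1 : Matrix (Fin 3) (Fin 3) ℝ)

/-- **Jacobi's formula**: the derivative of the determinant at `A` is
`H ↦ trace (adjugate A * H)`. -/
theorem Matrix.hasFDerivAt_det {𝕜 n : Type*} [NontriviallyNormedField 𝕜] [CompleteSpace 𝕜]
    [Fintype n] [DecidableEq n] (A : Matrix n n 𝕜) :
    HasFDerivAt (det : Matrix n n 𝕜 → 𝕜)
      (LinearMap.toContinuousLinearMap
        (traceLinearMap n 𝕜 𝕜 ∘ₗ LinearMap.mulLeft 𝕜 A.adjugate)) A := by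
  let f : ContinuousMultilinearMap 𝕜 (fun _ : n => n → 𝕜) 𝕜 :=
    ⟨(detRowAlternating : (n → 𝕜) [⋀^n]→ₗ[𝕜] 𝕜).toMultilinearMap,
      (continuous_id : Continuous (id : Matrix n n 𝕜 → Matrix n n 𝕜)).matrix_det⟩
  have hf : HasFDerivAt (det : Matrix n n 𝕜 → 𝕜) (f.linearDeriv A) A := f.hasFDerivAt A
  refine hf.congr_fderiv ?_
  refine ContinuousLinearMap.ext fun (H : Matrix n n 𝕜) => ?_
  calc f.linearDeriv A H = ∑ i, (A.updateRow i (H.row i)).det := f.linearDeriv_apply A H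
    _ = (A.adjugate * H).trace := by
      simp_rw [← cramer_transpose_apply, cramer_eq_adjugate_mulVec, ← adjugate_transpose]
      rw [trace_mul_comm]
      simp [trace, mul_apply, mulVec, dotProduct, row, mul_comm]

/-- Let `M` be a fixed invertible real `3×3` matrix and `C₀` invertible with
`det (C₀·M) = 1`.  Then the map `g C := trace ((det (C·M))^(−1/3) • (C·M))` (the trace of the
unimodular part of `C·M`) is differentiable at `C₀` and its Fréchet derivative at `C₀`
applied to a direction `H` is `trace (C₀⁻¹ · (C₀·M)^D · H)`; equivalently the Frobenius
gradient is `(C₀⁻¹·(C₀·M)^D)ᵀ`. -/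
theorem trace_unimodular_part_fderiv
    (M C₀ : Matrix (Fin 3) (Fin 3) ℝ) (hM : IsUnit M) (hC₀ : IsUnit C₀)
    (hdet : (C₀ * M).det = 1) :
    DifferentiableAt ℝ
      (fun C : Matrix (Fin 3) (Fin 3) ℝ =>
        (((C * M).det ^ (-(1 / 3) : ℝ)) • (C * M)).trace) C₀ ∧
    ∀ H : Matrix (Fin 3) (Fin 3) ℝ,
      fderiv ℝ
        (fun C : Matrix (Fin 3) (Fin 3) ℝ =>
          (((C * M).det ^ (-(1 / 3) : ℝ)) • (C * M)).trace) C₀ H =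
        (C₀⁻¹ * dev (C₀ * M) * H).trace := by
  have hmul : HasFDerivAt (fun C : Matrix (Fin 3) (Fin 3) ℝ => C * M)
      (LinearMap.toContinuousLinearMap (LinearMap.mulRight ℝ M)) C₀ :=
    (LinearMap.toContinuousLinearMap (LinearMap.mulRight ℝ M)).hasFDerivAt
  have htr := (LinearMap.toContinuousLinearMap
    (traceLinearMap (Fin 3) ℝ ℝ)).hasFDerivAt.comp C₀ hmul
  have hpow := ((hasFDerivAt_det (C₀ * M)).comp C₀ hmul).rpow_const
    (p := -(1 / 3)) (Or.inl (by simp [hdet]))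
  have hg := hpow.mul htr
  simp_rw [trace_smul, smul_eq_mul]
  refine ⟨hg.differentiableAt, fun H => ?_⟩
  have hadj : (C₀ * M).adjugate = M⁻¹ * C₀⁻¹ := by
    rw [← Matrix.mul_inv_rev, inv_def, hdet]
    simp
  have hdetM : IsUnit M.det := (isUnit_iff_isUnit_det M).1 hM
  have hdetC : IsUnit C₀.det := (isUnit_iff_isUnit_det C₀).1 hC₀
  have hJ : (M⁻¹ * C₀⁻¹ * (H * M)).trace = (C₀⁻¹ * H).trace := by
    rw [trace_mul_comm, ← Matrix.mul_assoc, Matrix.mul_assoc H, mul_nonsing_inv _ hdetM,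
      Matrix.mul_one, trace_mul_comm]
  have hdev : C₀⁻¹ * dev (C₀ * M) * H = M * H - ((C₀ * M).trace / 3) • (C₀⁻¹ * H) := by
    rw [dev, Matrix.mul_sub, nonsing_inv_mul_cancel_left _ _ hdetC, Matrix.sub_mul]
    simp
  refine (congrArg (· H) hg.fderiv).trans ?_
  change (C₀ * M).det ^ (-(1 / 3) : ℝ) * (H * M).trace + (C₀ * M).trace *
    ((-(1 / 3) * (C₀ * M).det ^ (-(1 / 3) - 1 : ℝ)) *
      ((C₀ * M).adjugate * (H * M)).trace) = _
  rw [hdev, hadj, hJ, hdet, trace_mul_comm H M, trace_sub, trace_smul]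
  simp only [Real.one_rpow, smul_eq_mul]
  ring
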